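/- Let γ⁰,γ¹,γ²,γ³ be Dirac matrices satisfying in addition the hermiticity conditions γ⁰ (γ^μ)† γ⁰ = γ^μ for all μ. Let ρ ≥ 0, ζ ∈ ℝ, λ ≠ 0 be real numbers, and let u ∈ ℝ⁴ be a unit timelike vector, η(u,u) = 1. Set Ψ := √ρ cos(ζ/λ) I + i √ρ sin(ζ/λ) Σ_μ u_μ γ^μ. Then the Riesz tensor T^{μν} := (1/4) tr(Ψ̄ γ^μ Ψ γ^ν) equals T^{μν} = ρ u^μ u^ν + ρ cos(2ζ/λ) (η^{μν} − u^μ u^ν). -/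

import Mathlib

open Matrix
noncomputable section

/-- The Minkowski metric `η = diag(1,-1,-1,-1)` on `ℝ⁴`. -/
def mink (μ ν : Fin 4) : ℝ := if μ = ν then (if μ = 0 then 1 else -1) else 0

/-- The Minkowski bilinear form on `ℝ⁴`. -/
def etaBil (v w : Fin 4 → ℝ) : ℝ := ∑ μ, ∑ ν, mink μ ν * v μ * w ν

/-- A matrix that anticommutes with an invertible square root of a scalar is traceless. -/
theorem trace_eq_zero_of_anticommute {n : Type*} [Fintype n] [DecidableEq n]
    {g M : Matrix n n ℂ} {c : ℂ} (hc : c ≠ 0) (hg : g * g = c • (1 : Matrix n n ℂ))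
    (h : g * M = -(M * g)) : M.trace = 0 := by
  have h1 : (M * (g * g)).trace = -(M * (g * g)).trace := by
    conv_lhs => rw [← mul_assoc, Matrix.trace_mul_comm, ← mul_assoc, h]
    rw [neg_mul, Matrix.trace_neg, mul_assoc]
  have h2 : (M * (g * g)).trace = c * M.trace := by
    simp [hg]
  rw [h2] at h1
  have h3 : c * M.trace = 0 := self_eq_neg.mp h1
  exact (mul_eq_zero.mp h3).resolve_left hc

theorem mink_comm (μ ν : Fin 4) : mink μ ν = mink ν μ := by
  unfold mink
  by_cases h : μ = ν
  · rw [h]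
  · rw [if_neg h, if_neg (Ne.symm h)]

theorem mink_self_ne_zero (μ : Fin 4) : mink μ μ ≠ 0 := by
  unfold mink
  split_ifs <;> simp_all

theorem sum_mink_mul_sum_mink (μ : Fin 4) (u : Fin 4 → ℝ) :
    ∑ ν, mink μ ν * ∑ κ, mink ν κ * u κ = u μ := by
  fin_cases μ <;> simp [Fin.sum_univ_four, mink]

theorem dirac_sq {γ : Fin 4 → Matrix (Fin 4) (Fin 4) ℂ}
    (hγ : ∀ μ ν, γ μ * γ ν + γ ν * γ μ
      = (2 * (mink μ ν : ℂ)) • (1 : Matrix (Fin 4) (Fin 4) ℂ))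
    (μ : Fin 4) : γ μ * γ μ = (mink μ μ : ℂ) • (1 : Matrix (Fin 4) (Fin 4) ℂ) := by
  have h := hγ μ μ
  rw [← two_smul ℂ, mul_smul] at h
  exact smul_right_injective _ (two_ne_zero' ℂ) h

theorem dirac_anticommute {γ : Fin 4 → Matrix (Fin 4) (Fin 4) ℂ}
    (hγ : ∀ μ ν, γ μ * γ ν + γ ν * γ μ
      = (2 * (mink μ ν : ℂ)) • (1 : Matrix (Fin 4) (Fin 4) ℂ))
    {μ ν : Fin 4} (h : μ ≠ ν) : γ μ * γ ν = -(γ ν * γ μ) := by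
  apply eq_neg_of_add_eq_zero_left
  rw [hγ μ ν]
  simp [mink, h]

theorem trace_dirac_mul_dirac {γ : Fin 4 → Matrix (Fin 4) (Fin 4) ℂ}
    (hγ : ∀ μ ν, γ μ * γ ν + γ ν * γ μ
      = (2 * (mink μ ν : ℂ)) • (1 : Matrix (Fin 4) (Fin 4) ℂ))
    (μ ν : Fin 4) : (γ μ * γ ν).trace = 4 * (mink μ ν : ℂ) := by
  have h := congrArg Matrix.trace (hγ μ ν)
  rw [Matrix.trace_add, Matrix.trace_mul_comm (γ ν)] at h
  simp at h
  linear_combination h / 2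

theorem trace_dirac_mul_dirac_mul_dirac {γ : Fin 4 → Matrix (Fin 4) (Fin 4) ℂ}
    (hγ : ∀ μ ν, γ μ * γ ν + γ ν * γ μ
      = (2 * (mink μ ν : ℂ)) • (1 : Matrix (Fin 4) (Fin 4) ℂ))
    (μ ν κ : Fin 4) : (γ μ * γ ν * γ κ).trace = 0 := by
  obtain ⟨d, h1, h2, h3⟩ : ∃ d : Fin 4, d ≠ μ ∧ d ≠ ν ∧ d ≠ κ := by
    revert μ ν κ; decide
  refine trace_eq_zero_of_anticommute (g := γ d)
    (Complex.ofReal_ne_zero.mpr (mink_self_ne_zero d)) (dirac_sq hγ d) ?_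
  have e1 := dirac_anticommute hγ h1
  have e2 := dirac_anticommute hγ h2
  have e3 := dirac_anticommute hγ h3
  calc γ d * (γ μ * γ ν * γ κ) = (γ d * γ μ) * γ ν * γ κ := by noncomm_ring
    _ = -(γ μ * (γ d * γ ν) * γ κ) := by rw [e1]; noncomm_ring
    _ = γ μ * γ ν * (γ d * γ κ) := by rw [e2]; noncomm_ring
    _ = -(γ μ * γ ν * γ κ * γ d) := by rw [e3]; noncomm_ring

/-- The Feynman slash of a covector. -/
def diracSlash (γ : Fin 4 → Matrix (Fin 4) (Fin 4) ℂ) (v : Fin 4 → ℝ) :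
    Matrix (Fin 4) (Fin 4) ℂ := ∑ μ, (v μ : ℂ) • γ μ

theorem diracSlash_mul_dirac_add {γ : Fin 4 → Matrix (Fin 4) (Fin 4) ℂ}
    (hγ : ∀ μ ν, γ μ * γ ν + γ ν * γ μ
      = (2 * (mink μ ν : ℂ)) • (1 : Matrix (Fin 4) (Fin 4) ℂ))
    (v : Fin 4 → ℝ) (μ : Fin 4) :
    diracSlash γ v * γ μ + γ μ * diracSlash γ v
      = ((2 * ∑ ν, mink μ ν * v ν : ℝ) : ℂ) • (1 : Matrix (Fin 4) (Fin 4) ℂ) := by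
  simp only [diracSlash, Finset.sum_mul, Finset.mul_sum, ← Finset.sum_add_distrib,
    smul_mul_assoc, mul_smul_comm, ← smul_add, hγ, smul_smul, Complex.ofReal_sum, Finset.sum_smul]
  refine Finset.sum_congr rfl fun ν _ => ?_
  rw [mink_comm ν μ]
  push_cast
  congr 1
  ring

theorem diracSlash_sq {γ : Fin 4 → Matrix (Fin 4) (Fin 4) ℂ}
    (hγ : ∀ μ ν, γ μ * γ ν + γ ν * γ μ
      = (2 * (mink μ ν : ℂ)) • (1 : Matrix (Fin 4) (Fin 4) ℂ))
    (v : Fin 4 → ℝ) :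
    diracSlash γ v * diracSlash γ v
      = ((∑ μ, v μ * ∑ ν, mink μ ν * v ν : ℝ) : ℂ) • (1 : Matrix (Fin 4) (Fin 4) ℂ) := by
  have h : (2 : ℂ) • (diracSlash γ v * diracSlash γ v)
      = (2 : ℂ) • (((∑ μ, v μ * ∑ ν, mink μ ν * v ν : ℝ) : ℂ)
        • (1 : Matrix (Fin 4) (Fin 4) ℂ)) := by
    calc (2 : ℂ) • (diracSlash γ v * diracSlash γ v)
        = ∑ μ, (v μ : ℂ) • (diracSlash γ v * γ μ + γ μ * diracSlash γ v) := by
          simp only [smul_add, Finset.sum_add_distrib, ← mul_smul_comm, ← Finset.mul_sum]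
          rw [two_smul]
          simp only [mul_smul_comm, ← smul_mul_assoc, ← Finset.sum_mul]
          exact mul_add _ _ _
      _ = _ := by
          simp only [diracSlash_mul_dirac_add hγ, smul_smul, ← Finset.sum_smul]
          congr 1
          push_cast
          rw [Finset.mul_sum]
          refine Finset.sum_congr rfl fun μ _ => ?_
          ring
  exact smul_right_injective _ (two_ne_zero' ℂ) h

theorem trace_diracSlash_mul_dirac {γ : Fin 4 → Matrix (Fin 4) (Fin 4) ℂ}
    (hγ : ∀ μ ν, γ μ * γ ν + γ ν * γ μ
      = (2 * (mink μ ν : ℂ)) • (1 : Matrix (Fin 4) (Fin 4) ℂ))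
    (v : Fin 4 → ℝ) (μ : Fin 4) :
    (diracSlash γ v * γ μ).trace = 4 * ((∑ ν, mink μ ν * v ν : ℝ) : ℂ) := by
  have h := congrArg Matrix.trace (diracSlash_mul_dirac_add hγ v μ)
  rw [Matrix.trace_add, Matrix.trace_mul_comm (γ μ), Matrix.trace_smul, Matrix.trace_one,
    Complex.ofReal_mul] at h
  simp only [Fintype.card_fin, smul_eq_mul] at h
  push_cast at h ⊢
  linear_combination h / 2

theorem trace_diracSlash_mul_dirac_mul_dirac {γ : Fin 4 → Matrix (Fin 4) (Fin 4) ℂ}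
    (hγ : ∀ μ ν, γ μ * γ ν + γ ν * γ μ
      = (2 * (mink μ ν : ℂ)) • (1 : Matrix (Fin 4) (Fin 4) ℂ))
    (v : Fin 4 → ℝ) (μ ν : Fin 4) :
    (diracSlash γ v * γ μ * γ ν).trace = 0 := by
  simp [diracSlash, Finset.sum_mul, Matrix.trace_sum, trace_dirac_mul_dirac_mul_dirac hγ]

theorem diracAdjoint_diracSlash {γ : Fin 4 → Matrix (Fin 4) (Fin 4) ℂ}
    (hHerm : ∀ μ, γ 0 * (γ μ)ᴴ * γ 0 = γ μ) (v : Fin 4 → ℝ) :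
    γ 0 * (diracSlash γ v)ᴴ * γ 0 = diracSlash γ v := by
  simp [diracSlash, Matrix.conjTranspose_sum, Finset.mul_sum, Finset.sum_mul, hHerm]

/-- For Dirac matrices satisfying the hermiticity conditions, `ρ ≥ 0`, `λ ≠ 0`, a unit
timelike vector `u`, and `Ψ = √ρ cos(ζ/λ) I + i √ρ sin(ζ/λ) u_μ γ^μ`, the Riesz tensor
`T^{μν} = (1/4) tr(Ψ̄ γ^μ Ψ γ^ν)` equals `ρ u^μ u^ν + ρ cos(2ζ/λ) (η^{μν} − u^μ u^ν)`. -/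
theorem riesz_tensor_perfect_fluid_form
    (γ : Fin 4 → Matrix (Fin 4) (Fin 4) ℂ)
    (hClifford : ∀ μ ν, γ μ * γ ν + γ ν * γ μ
      = (2 * (mink μ ν : ℂ)) • (1 : Matrix (Fin 4) (Fin 4) ℂ))
    (hHerm : ∀ μ, γ 0 * (γ μ)ᴴ * γ 0 = γ μ)
    (ρ ζ lam : ℝ) (hρ : 0 ≤ ρ) (hlam : lam ≠ 0)
    (u : Fin 4 → ℝ) (hu : etaBil u u = 1)
    (ulow : Fin 4 → ℝ) (hulow : ∀ μ, ulow μ = ∑ ν, mink μ ν * u ν)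
    (Ψ : Matrix (Fin 4) (Fin 4) ℂ)
    (hΨ : Ψ = ((Real.sqrt ρ * Real.cos (ζ / lam) : ℝ) : ℂ) • (1 : Matrix (Fin 4) (Fin 4) ℂ)
        + ∑ μ, (Complex.I * ((Real.sqrt ρ * Real.sin (ζ / lam) : ℝ) : ℂ)
            * ((ulow μ : ℝ) : ℂ)) • γ μ)
    (T : Fin 4 → Fin 4 → ℂ)
    (hT : ∀ μ ν, T μ ν = (1/4) * Matrix.trace ((γ 0 * Ψᴴ * γ 0) * γ μ * Ψ * γ ν)) :
    ∀ μ ν, T μ ν =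
      ((ρ * u μ * u ν + ρ * Real.cos (2 * ζ / lam) * (mink μ ν - u μ * u ν) : ℝ) : ℂ) := by
  have hS2 : diracSlash γ ulow * diracSlash γ ulow = 1 := by
    have h : ∑ μ, ulow μ * ∑ ν, mink μ ν * ulow ν = 1 := by
      rw [← hu]
      simp only [hulow, sum_mink_mul_sum_mink, etaBil]
      refine Finset.sum_congr rfl fun μ _ => ?_
      rw [Finset.sum_mul]
      refine Finset.sum_congr rfl fun ν _ => ?_
      ring
    rw [diracSlash_sq hClifford, h, Complex.ofReal_one, one_smul]
  have hraise : ∀ μ, ∑ ν, mink μ ν * ulow ν = u μ := fun μ => by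
    simp only [hulow, sum_mink_mul_sum_mink]
  have hadj := diracAdjoint_diracSlash hHerm ulow
  have hanti := diracSlash_mul_dirac_add hClifford ulow
  have htr := trace_diracSlash_mul_dirac hClifford ulow
  have htr3 := trace_diracSlash_mul_dirac_mul_dirac hClifford ulow
  have h00 : γ 0 * γ 0 = 1 := by
    rw [dirac_sq hClifford 0]; simp [mink]
  have hΨS : Ψ = ((√ρ * Real.cos (ζ / lam) : ℝ) : ℂ) • (1 : Matrix (Fin 4) (Fin 4) ℂ)
      + (Complex.I * ((√ρ * Real.sin (ζ / lam) : ℝ) : ℂ)) • diracSlash γ ulow := by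
    rw [hΨ, diracSlash, Finset.smul_sum]
    simp only [smul_smul]
  simp only [hraise] at hanti htr
  generalize diracSlash γ ulow = S at *
  have hab : (√ρ * Real.cos (ζ / lam)) ^ 2 = ρ * Real.cos (ζ / lam) ^ 2
      ∧ (√ρ * Real.sin (ζ / lam)) ^ 2 = ρ * Real.sin (ζ / lam) ^ 2 := by
    constructor <;> rw [mul_pow, Real.sq_sqrt hρ]
  obtain ⟨ha, hb⟩ := hab
  generalize √ρ * Real.cos (ζ / lam) = a at *
  generalize √ρ * Real.sin (ζ / lam) = b at *
  have hΨbar : γ 0 * Ψᴴ * γ 0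
      = (a : ℂ) • (1 : Matrix (Fin 4) (Fin 4) ℂ) - (Complex.I * b) • S := by
    rw [hΨS]
    simp only [Matrix.conjTranspose_add, Matrix.conjTranspose_smul, Matrix.conjTranspose_one,
      mul_add, add_mul, mul_smul_comm, smul_mul_assoc, mul_one, h00, hadj]
    simp [sub_eq_add_neg]
  intro μ ν
  have hSS : (S * γ μ * S * γ ν).trace = 8 * u μ * u ν - 4 * (mink μ ν : ℂ) := by
    have h : S * γ μ * S = ((2 * u μ : ℝ) : ℂ) • S - γ μ := by
      rw [eq_sub_of_add_eq (hanti μ), sub_mul, mul_assoc, hS2]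
      simp
    rw [h, sub_mul, Matrix.trace_sub, smul_mul_assoc, Matrix.trace_smul, htr,
      trace_dirac_mul_dirac hClifford]
    push_cast
    simp only [smul_eq_mul]
    ring
  have h3 : (γ μ * S * γ ν).trace = 0 := by
    rw [mul_assoc, Matrix.trace_mul_comm, htr3]
  have hexp : (γ 0 * Ψᴴ * γ 0) * γ μ * Ψ * γ ν
      = ((a : ℂ) ^ 2) • (γ μ * γ ν) + (Complex.I * a * b) • (γ μ * S * γ ν)
        - (Complex.I * a * b) • (S * γ μ * γ ν) + ((b : ℂ) ^ 2) • (S * γ μ * S * γ ν) := by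
    rw [hΨbar, hΨS]
    simp only [mul_add, add_mul, sub_mul, mul_smul_comm, smul_mul_assoc, mul_one, one_mul,
      smul_sub, smul_smul]
    have hI : Complex.I * b * (Complex.I * b) = -(b : ℂ) ^ 2 := by
      linear_combination (b : ℂ) ^ 2 * Complex.I_mul_I
    rw [hI]
    module
  rw [hT, hexp, Matrix.trace_add, Matrix.trace_sub, Matrix.trace_add]
  simp only [Matrix.trace_smul, h3, htr3, hSS, trace_dirac_mul_dirac hClifford, smul_eq_mul]
  have hreal : ρ * u μ * u ν + ρ * Real.cos (2 * ζ / lam) * (mink μ ν - u μ * u ν)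
      = a ^ 2 * mink μ ν + b ^ 2 * (2 * u μ * u ν - mink μ ν) := by
    rw [ha, hb, mul_div_assoc, Real.cos_two_mul, Real.sin_sq]
    ring
  rw [hreal]
  push_cast
  ring
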